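/- Every permutation of an infinite set Ω is the product of two replete permutations, where a permutation is replete if it has |Ω| orbits of each positive cardinality ≤ ℵ₀ (including fixed points and infinite orbits). -/

import Mathlib

/-- The orbit of `x` under the permutation `f`. -/
def permOrbit {Ω : Type*} (f : Equiv.Perm Ω) (x : Ω) : Set Ω :=
  {y : Ω | ∃ n : ℤ, (f ^ n) x = y}

/-- A permutation of an infinite set `Ω` is replete if for every positive
cardinality `c ≤ ℵ₀` it has `|Ω|` orbits of cardinality `c`. -/
def Replete {Ω : Type*} (f : Equiv.Perm Ω) : Prop :=
  ∀ c : Cardinal, 0 < c → c ≤ Cardinal.aleph0 →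
    Cardinal.mk {s : Set Ω // (∃ x : Ω, s = permOrbit f x) ∧ Cardinal.mk ↥s = c} =
      Cardinal.mk Ω

open Cardinal in
theorem halves {Ω : Type*} [Infinite Ω] (X : Set Ω) (hX : #X = #Ω) :
    ∃ Y Z : Set Ω, Y ⊆ X ∧ Z ⊆ X ∧ Disjoint Y Z ∧ #Y = #Ω ∧ #Z = #Ω := by
  have h : #(Ω ⊕ Ω) = #X := by
    rw [hX, mk_sum, lift_id, add_mk_eq_self]
  obtain ⟨e⟩ := Cardinal.eq.1 h
  refine ⟨Set.range fun w => (e (Sum.inl w) : Ω), Set.range fun w => (e (Sum.inr w) : Ω),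
    ?_, ?_, ?_, ?_, ?_⟩
  · rintro _ ⟨w, rfl⟩; exact (e _).2
  · rintro _ ⟨w, rfl⟩; exact (e _).2
  · rw [Set.disjoint_left]
    rintro _ ⟨w, rfl⟩ ⟨v, hv⟩
    have := e.injective (Subtype.ext hv)
    cases this
  · apply mk_range_eq
    intro x y hxy
    exact Sum.inl_injective (e.injective (Subtype.ext hxy))
  · apply mk_range_eq
    intro x y hxy
    exact Sum.inr_injective (e.injective (Subtype.ext hxy))

open Cardinal in
theorem exists_sets {Ω : Type*} [Infinite Ω] (f : Equiv.Perm Ω) :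
    ∃ A B : Set Ω, #A = #Ω ∧ #B = #Ω ∧ Disjoint A B ∧ Disjoint A (f '' B) := by
  obtain ⟨C, D, -, -, hCD, hC, hD⟩ := halves (Set.univ : Set Ω) mk_univ
  by_cases h : #(D \ f '' C : Set Ω) = #Ω
  · exact ⟨_, C, h, hC, hCD.symm.mono_left Set.sdiff_subset, Set.disjoint_sdiff_left⟩
  have h2 : #(D ∩ f '' C : Set Ω) = #Ω := by
    by_contra h2
    have l1 := lt_of_le_of_ne (mk_set_le _) h
    have l2 := lt_of_le_of_ne (mk_set_le _) h2
    have := add_lt_of_lt (aleph0_le_mk Ω) l1 l2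
    have h3 := mk_union_le (D \ f '' C) (D ∩ f '' C)
    rw [Set.sdiff_union_inter, hD] at h3
    exact absurd this (not_lt.2 h3)
  obtain ⟨Y, Z, hY, hZ, hYZ, cY, cZ⟩ := halves _ h2
  refine ⟨Y, f ⁻¹' Z, cY, ?_, ?_, ?_⟩
  · rw [← cZ, ← Equiv.image_symm_eq_preimage]
    exact mk_image_eq f.symm.injective
  · rw [Set.disjoint_left] at *
    intro x hx hx'
    obtain ⟨c, hc, hce⟩ := (hZ hx').2
    rw [f.injective hce] at hc
    exact hCD hc (hY hx).1
  · rwa [Set.image_preimage_eq _ f.surjective]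

/-- Index type: `Ω` many cycles of each length. -/
abbrev TT (Ω : Type*) := Ω × (Σ n : ℕ, ZMod n)

/-- The shift. -/
def shiftTT (Ω : Type*) : Equiv.Perm (TT Ω) :=
  Equiv.prodCongr (Equiv.refl Ω) (Equiv.sigmaCongrRight fun _ => Equiv.addRight 1)

theorem shiftTT_apply {Ω : Type*} (w : Ω) (n : ℕ) (k : ZMod n) :
    shiftTT Ω (w, ⟨n, k⟩) = (w, ⟨n, k + 1⟩) := rfl

open Cardinal in
theorem mk_TT (Ω : Type*) [Infinite Ω] : #(TT Ω) = #Ω := by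
  have : Countable (Σ n : ℕ, ZMod n) := by
    have : ∀ n, Countable (ZMod n) := fun n => by
      cases n
      · exact inferInstanceAs (Countable ℤ)
      · exact inferInstanceAs (Countable (Fin _))
    infer_instance
  have : Nonempty (Σ n : ℕ, ZMod n) := ⟨⟨0, 0⟩⟩
  rw [mk_prod, lift_uzero]
  apply mul_eq_left (aleph0_le_mk Ω)
  · refine le_trans ?_ (aleph0_le_mk Ω)
    simp
  · rw [Ne, lift_eq_zero]; exact mk_ne_zero _

open Cardinal in
theorem replete_of {Ω : Type*} [Infinite Ω] (g : Equiv.Perm Ω) (e : TT Ω → Ω)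
    (he : Function.Injective e) (hg : ∀ t, g (e t) = e (shiftTT Ω t)) : Replete g := by
  have hz : ∀ (w : Ω) (n : ℕ) (j : ℤ) (k : ZMod n),
      (g ^ j) (e (w, ⟨n, k⟩)) = e (w, ⟨n, k + j⟩) := by
    intro w n j
    induction j with
    | zero => intro k; simp
    | succ i ih =>
      intro k
      rw [add_comm, zpow_add, Equiv.Perm.mul_apply, ih, zpow_one, hg, shiftTT_apply]
      push_cast
      congr 3
      ring
    | pred i ih =>
      intro k
      rw [sub_eq_neg_add, zpow_add, Equiv.Perm.mul_apply, ih, zpow_neg_one,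
        Equiv.Perm.inv_eq_iff_eq, hg, shiftTT_apply]
      push_cast
      congr 3
      ring
  have horb : ∀ (w : Ω) (n : ℕ),
      permOrbit g (e (w, ⟨n, 0⟩)) = Set.range fun k : ZMod n => e (w, ⟨n, k⟩) := by
    intro w n
    ext y
    constructor
    · rintro ⟨j, rfl⟩
      exact ⟨_, (hz w n j 0).symm⟩
    · rintro ⟨k, rfl⟩
      obtain ⟨j, rfl⟩ := ZMod.intCast_surjective k
      refine ⟨j, ?_⟩
      rw [hz, zero_add]
  intro c hc0 hc
  have hn : ∃ n : ℕ, lift.{_, 0} #(ZMod n) = c := by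
    rcases hc.lt_or_eq with h | h
    · obtain ⟨n, rfl⟩ := lt_aleph0.1 h
      have : n ≠ 0 := by rintro rfl; simp at hc0
      have : NeZero n := ⟨this⟩
      exact ⟨n, by simp [ZMod.card]⟩
    · refine ⟨0, ?_⟩
      have : #(ZMod 0) = ℵ₀ := mk_int
      rw [this, h, lift_aleph0]
  obtain ⟨n, hn⟩ := hn
  have inj : ∀ w, Function.Injective fun k : ZMod n => e (w, ⟨n, k⟩) := by
    intro w k l hkl
    have := he hkl
    simpa using this
  apply le_antisymm
  · have : Function.Injective fun s : {s : Set Ω // (∃ x : Ω, s = permOrbit g x) ∧ #↥s = c} =>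
        s.2.1.choose := by
      intro s t hst
      apply Subtype.ext
      rw [s.2.1.choose_spec, t.2.1.choose_spec]
      exact congrArg _ hst
    exact mk_le_of_injective this
  · refine mk_le_of_injective (f := fun w => ⟨permOrbit g (e (w, ⟨n, 0⟩)), ⟨_, rfl⟩, ?_⟩) ?_
    · rw [horb, ← hn]
      have := mk_range_eq_of_injective (inj w)
      simpa using this
    · intro w v hwv
      have h1 := congrArg Subtype.val hwv
      simp only [horb] at h1
      have : e (w, ⟨n, 0⟩) ∈ Set.range fun k : ZMod n => e (v, ⟨n, k⟩) := by
        rw [← h1]; exact ⟨0, rfl⟩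
      obtain ⟨k, hk⟩ := this
      exact (congrArg Prod.fst (he hk)).symm

open Cardinal in
theorem extend_perm {Ω S : Type*} (p q : S → Ω) (hp : Function.Injective p)
    (hq : Function.Injective q)
    (h : #((Set.range p)ᶜ : Set Ω) = #((Set.range q)ᶜ : Set Ω)) :
    ∃ g : Equiv.Perm Ω, ∀ t, g (p t) = q t := by
  let F : Set.range p ↪ Ω :=
    ⟨fun x => q ((Equiv.ofInjective p hp).symm x),
      hq.comp (Equiv.ofInjective p hp).symm.injective⟩
  have hF : Set.range F = Set.range q :=
    (Equiv.ofInjective p hp).symm.surjective.range_comp q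
  obtain ⟨g, hg⟩ := extend_function F (by rw [hF]; exact Cardinal.eq.1 h)
  refine ⟨g, fun t => ?_⟩
  have := hg ⟨p t, t, rfl⟩
  rw [this]
  exact congrArg q (Equiv.ofInjective_symm_apply hp t)

open Cardinal in
theorem stmt18 {Ω : Type*} [Infinite Ω] (f : Equiv.Perm Ω) :
    ∃ g h : Equiv.Perm Ω, Replete g ∧ Replete h ∧ f = g * h := by
  obtain ⟨A, B, hA, hB, hAB, hAf⟩ := exists_sets f
  obtain ⟨A1, A2, h1, h2, h12, c1, c2⟩ := halves A hA
  obtain ⟨a⟩ := Cardinal.eq.1 ((mk_TT Ω).trans c1.symm)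
  obtain ⟨b⟩ := Cardinal.eq.1 ((mk_TT Ω).trans hB.symm)
  rw [Set.disjoint_left] at hAB hAf h12
  let s := shiftTT Ω
  let p : TT Ω ⊕ TT Ω → Ω := Sum.elim (fun t => (a t : Ω)) (fun t => (b t : Ω))
  let q : TT Ω ⊕ TT Ω → Ω := Sum.elim (fun t => (a (s t) : Ω)) (fun t => f (b (s.symm t) : Ω))
  have hp : Function.Injective p := by
    apply Function.Injective.sumElim
    · exact Subtype.val_injective.comp a.injective
    · exact Subtype.val_injective.comp b.injective
    · intro x y hxy
      exact hAB (h1 (a x).2) (hxy ▸ (b y).2)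
  have hq : Function.Injective q := by
    apply Function.Injective.sumElim
    · exact (Subtype.val_injective.comp a.injective).comp s.injective
    · exact f.injective.comp ((Subtype.val_injective.comp b.injective).comp s.symm.injective)
    · intro x y hxy
      exact hAf (h1 (a (s x)).2) (hxy ▸ ⟨_, (b (s.symm y)).2, rfl⟩)
  have kp : A2 ⊆ (Set.range p)ᶜ := by
    rintro x hx ⟨t | t, rfl⟩
    · exact h12 (a t).2 hx
    · exact hAB (h2 hx) (b t).2
  have kq : A2 ⊆ (Set.range q)ᶜ := by
    rintro x hx ⟨t | t, rfl⟩
    · exact h12 (a (s t)).2 hx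
    · exact hAf (h2 hx) ⟨_, (b (s.symm t)).2, rfl⟩
  have big : ∀ X : Set Ω, A2 ⊆ X → #X = #Ω := fun X hX =>
    le_antisymm (mk_set_le _) (c2 ▸ mk_le_mk_of_subset hX)
  obtain ⟨g, hg⟩ := extend_perm p q hp hq ((big _ kp).trans (big _ kq).symm)
  refine ⟨g, g⁻¹ * f, ?_, ?_, by simp⟩
  · exact replete_of g (fun t => (a t : Ω)) (Subtype.val_injective.comp a.injective)
      fun t => hg (Sum.inl t)
  · refine replete_of _ (fun t => (b t : Ω)) (Subtype.val_injective.comp b.injective)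
      fun t => ?_
    rw [Equiv.Perm.mul_apply, Equiv.Perm.inv_eq_iff_eq]
    have := hg (Sum.inr (s t))
    simp only [p, q, Sum.elim_inr, Equiv.symm_apply_apply] at this
    exact this.symm
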